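/- Let G be a directed polymatroidal network such that there exists at least one vector x ∈ ℝ^{V∪E} with ∑_{v∈V} deg_v x_v = 0 and ∑_{v∈V} deg_v x_v² > 0. Then there exists a set S ⊆ V with 0 < vol(S) ≤ vol(V)/2 such that cutval(S) ≤ 32 · √(γ₂) · vol(S). (This is the hard direction of the Cheeger inequality for polymatroidal networks: Φ_G ≤ 32·√γ₂.) -/

import Mathlib

open MeasureTheory

/-- Lovász extension of the set function `f`, with ground set `D`,
evaluated at the (nonnegative) vector `x`. -/
noncomputable def lovOn {E : Type*} (f : Set E → ℝ) (D : Set E) (x : E → ℝ) : ℝ :=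
  ∫ θ in Set.Ioi (0 : ℝ), f (D ∩ {e | θ ≤ x e})

/-- A directed polymatroidal network on vertex type `V` and edge type `E`. -/
structure PolyNet (V E : Type*) [Fintype V] [Fintype E] where
  tail : E → V
  head : E → V
  w : V → ℝ
  w_nonneg : ∀ v, 0 ≤ w v
  ρp : V → Set E → ℝ
  ρm : V → Set E → ℝ
  ρp_nonneg : ∀ v A, 0 ≤ ρp v A
  ρm_nonneg : ∀ v A, 0 ≤ ρm v A
  ρp_empty : ∀ v, ρp v ∅ = 0
  ρm_empty : ∀ v, ρm v ∅ = 0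
  ρp_mono : ∀ v A B, A ⊆ B → B ⊆ {e | tail e = v} → ρp v A ≤ ρp v B
  ρm_mono : ∀ v A B, A ⊆ B → B ⊆ {e | head e = v} → ρm v A ≤ ρm v B
  ρp_submod : ∀ v A B, A ⊆ {e | tail e = v} → B ⊆ {e | tail e = v} →
    ρp v (A ∪ B) + ρp v (A ∩ B) ≤ ρp v A + ρp v B
  ρm_submod : ∀ v A B, A ⊆ {e | head e = v} → B ⊆ {e | head e = v} →
    ρm v (A ∪ B) + ρm v (A ∩ B) ≤ ρm v A + ρm v B

namespace PolyNet

variable {V E : Type*} [Fintype V] [Fintype E] (N : PolyNet V E)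

/-- The set of edges leaving `v`. -/
def outE (v : V) : Set E := {e | N.tail e = v}

/-- The set of edges entering `v`. -/
def inE (v : V) : Set E := {e | N.head e = v}

/-- The degree of a vertex. -/
noncomputable def deg (v : V) : ℝ := N.ρp v (N.outE v) + N.ρm v (N.inE v)

/-- The volume of a set of vertices. -/
noncomputable def vol (S : Set V) : ℝ := ∑ v, S.indicator N.deg v

/-- The total weight of a set of vertices. -/
noncomputable def wsum (S : Set V) : ℝ := ∑ v, S.indicator N.w v

/-- An assignment `g` of (cut) edges to vertices is valid on `F` if every edge of `F` is
assigned to one of its endpoints. -/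
def valid (F : Set E) (g : E → V) : Prop := ∀ e ∈ F, g e = N.tail e ∨ g e = N.head e

/-- The cost of the cut `F` under the assignment `g`. -/
noncomputable def cutCost (F : Set E) (g : E → V) : ℝ :=
  ∑ v, (N.ρp v (N.outE v ∩ F ∩ {e | g e = v}) + N.ρm v (N.inE v ∩ F ∩ {e | g e = v}))

/-- The cost of the cut `F`: minimum over valid assignments. -/
noncomputable def cut (F : Set E) : ℝ :=
  sInf {c | ∃ g : E → V, N.valid F g ∧ c = N.cutCost F g}

/-- Edges from `S` to its complement. -/
def dplus (S : Set V) : Set E := {e | N.tail e ∈ S ∧ N.head e ∉ S}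

/-- Edges from the complement of `S` into `S`. -/
def dminus (S : Set V) : Set E := {e | N.tail e ∉ S ∧ N.head e ∈ S}

/-- The (directed) value of the cut induced by `S`. -/
noncomputable def cutval (S : Set V) : ℝ := min (N.cut (N.dplus S)) (N.cut (N.dminus S))

/-- The symmetric value of the cut induced by `S`. -/
noncomputable def symcutval (S : Set V) : ℝ := N.cut (N.dplus S) + N.cut (N.dminus S)

/-- The Rayleigh quotient `R⁺`. -/
noncomputable def Rp (x : V ⊕ E → ℝ) : ℝ :=
  (∑ v, (lovOn (N.ρp v) (N.outE v) (fun e => (max 0 (x (Sum.inl v) - x (Sum.inr e)))^2)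
       + lovOn (N.ρm v) (N.inE v) (fun e => (max 0 (x (Sum.inr e) - x (Sum.inl v)))^2)))
  / ∑ v, N.deg v * (x (Sum.inl v))^2

/-- The Rayleigh quotient `R⁻`. -/
noncomputable def Rm (x : V ⊕ E → ℝ) : ℝ :=
  (∑ v, (lovOn (N.ρp v) (N.outE v) (fun e => (max 0 (x (Sum.inr e) - x (Sum.inl v)))^2)
       + lovOn (N.ρm v) (N.inE v) (fun e => (max 0 (x (Sum.inl v) - x (Sum.inr e)))^2)))
  / ∑ v, N.deg v * (x (Sum.inl v))^2

/-- The Rayleigh quotient `R`. -/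
noncomputable def Ray (x : V ⊕ E → ℝ) : ℝ := min (N.Rp x) (N.Rm x)

/-- The symmetric Rayleigh quotient `R̄`. -/
noncomputable def RaySym (x : V ⊕ E → ℝ) : ℝ := N.Rp x + N.Rm x

/-- The spectral gap `γ₂` of a polymatroidal network. -/
noncomputable def gap : ℝ :=
  sInf {r | ∃ x : V ⊕ E → ℝ, (∑ v, N.deg v * x (Sum.inl v)) = 0 ∧
    (0 < ∑ v, N.deg v * (x (Sum.inl v))^2) ∧ r = N.Ray x}

end PolyNet

/-- The integrand of `lovOn f D (y ^ 2)` after the substitution `θ = s ^ 2`, extended by zero to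
the nonpositive reals. -/
noncomputable def sqLayer {E : Type*} (f : Set E → ℝ) (D : Set E) (y : E → ℝ) : ℝ → ℝ :=
  (Set.Ioi (0 : ℝ)).indicator fun s => 2 * s * f (D ∩ {e | s ≤ y e})

section Layer

variable {E : Type*} {f : Set E → ℝ} {D : Set E}

open Set

lemma sqLayer_nonneg (h0 : ∀ A, 0 ≤ f A) (y : E → ℝ) (s : ℝ) : 0 ≤ sqLayer f D y s := by
  refine indicator_nonneg (fun s hs => ?_) s
  have := h0 (D ∩ {e | s ≤ y e})
  have : (0 : ℝ) < s := hs
  positivity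

lemma sqLayer_of_pos (y : E → ℝ) {s : ℝ} (hs : 0 < s) :
    sqLayer f D y s = 2 * s * f (D ∩ {e | s ≤ y e}) :=
  indicator_of_mem (mem_Ioi.2 hs) _

lemma integral_sqLayer (y : E → ℝ) (hy : ∀ e, 0 ≤ y e) :
    ∫ s, sqLayer f D y s = lovOn f D (fun e => y e ^ 2) := by
  unfold sqLayer lovOn
  rw [integral_indicator measurableSet_Ioi,
    ← integral_comp_rpow_Ioi (fun θ => f (D ∩ {e | θ ≤ y e ^ 2})) (two_ne_zero' ℝ)]
  refine setIntegral_congr_fun measurableSet_Ioi fun s hs => ?_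
  have hs : (0 : ℝ) < s := hs
  have hset : {e | s ≤ y e} = {e | s ^ (2 : ℝ) ≤ y e ^ 2} := by
    ext e
    simp only [mem_ofPred_eq, Real.rpow_two]
    exact (pow_le_pow_iff_left₀ hs.le (hy e) two_ne_zero).symm
  have hpow : s ^ ((2 : ℝ) - 1) = s := by norm_num
  simp only [hset, hpow, smul_eq_mul, abs_two]

lemma integrable_sqLayer [Finite E] (h0 : ∀ A, 0 ≤ f A) (he : f ∅ = 0)
    (hm : ∀ A B, A ⊆ B → B ⊆ D → f A ≤ f B) (y : E → ℝ) :
    Integrable (sqLayer f D y) := by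
  obtain ⟨M, hM⟩ := (Set.finite_range y).bddAbove
  have hM' : ∀ e, y e ≤ M := fun e => hM ⟨e, rfl⟩
  have hanti : Antitone fun s : ℝ => f (D ∩ {e | s ≤ y e}) := fun s t hst =>
    hm _ _ (inter_subset_inter_right _ fun e (he : t ≤ y e) => hst.trans he) inter_subset_left
  have hmeas : Measurable (sqLayer f D y) :=
    ((measurable_const.mul measurable_id).mul hanti.measurable).indicator measurableSet_Ioi
  have hdom : Integrable ((Ioc (0 : ℝ) M).indicator fun _ => 2 * M * f D) :=
    (integrable_indicator_iff measurableSet_Ioc).2 (integrableOn_const (by simp))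
  refine hdom.mono' hmeas.aestronglyMeasurable (Filter.Eventually.of_forall fun s => ?_)
  rw [Real.norm_of_nonneg (sqLayer_nonneg h0 y s)]
  by_cases hs : 0 < s
  · rw [sqLayer_of_pos y hs]
    by_cases hsM : s ≤ M
    · rw [indicator_of_mem (mem_Ioc.2 ⟨hs, hsM⟩)]
      have := hm (D ∩ {e | s ≤ y e}) D inter_subset_left Subset.rfl
      have := h0 (D ∩ {e | s ≤ y e})
      have : 0 ≤ M := hs.le.trans hsM
      gcongr
    · have : D ∩ {e | s ≤ y e} = ∅ := by
        ext e
        simp only [mem_inter_iff, mem_ofPred_eq, mem_empty_iff_false, iff_false, not_and]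
        intro _ h
        exact hsM (h.trans (hM' e))
      rw [this, he, mul_zero]
      exact indicator_nonneg (fun t ht => by
        have := h0 D
        have : 0 ≤ M := ht.1.le.trans ht.2
        positivity) s
  · rw [sqLayer, indicator_of_notMem (by simpa using hs), indicator_of_notMem]
    exact fun h => hs h.1

/-- Pointwise bound at the threshold `t` for edges lying below the vertex value `a`. -/
lemma two_mul_below_le (h0 : ∀ A, 0 ≤ f A) (he : f ∅ = 0)
    (hm : ∀ A B, A ⊆ B → B ⊆ D → f A ≤ f B) {a κ t : ℝ} (ha : 0 ≤ a) (hκ : 0 < κ)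
    (z : E → ℝ) :
    2 * t * f (D ∩ {e | z e < t ∧ t ≤ a}) ≤
      (Icc (a - κ * a) a).indicator (fun _ => 2 * a * f D) t
        + 1 / κ * sqLayer f D (fun e => max 0 (a - z e)) (a - t) := by
  set y : E → ℝ := fun e => max 0 (a - z e) with hy
  have hD := h0 D
  have hG := sqLayer_nonneg (D := D) h0 y (a - t)
  have hI : 0 ≤ (Icc (a - κ * a) a).indicator (fun _ => 2 * a * f D) t :=
    indicator_nonneg (fun _ _ => by positivity) t
  have hR : 0 ≤ 1 / κ * sqLayer f D y (a - t) := by positivity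
  have hc0 := h0 (D ∩ {e | z e < t ∧ t ≤ a})
  have hcD := hm (D ∩ {e | z e < t ∧ t ≤ a}) D inter_subset_left Subset.rfl
  rcases lt_or_ge a t with h | h
  · have : D ∩ {e | z e < t ∧ t ≤ a} = ∅ := by
      ext e; simp [h.not_ge]
    rw [this, he]
    linarith
  by_cases hs : a - t ≤ κ * a
  · rw [indicator_of_mem (mem_Icc.2 ⟨by linarith, h⟩)]
    have : 2 * t * f (D ∩ {e | z e < t ∧ t ≤ a}) ≤ 2 * a * f D := by gcongr
    linarith
  · push Not at hs
    have hs0 : 0 < a - t := lt_of_le_of_lt (by positivity) hs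
    have hc := hm (D ∩ {e | z e < t ∧ t ≤ a}) (D ∩ {e | a - t ≤ y e})
      (inter_subset_inter_right _ fun e (h : z e < t ∧ t ≤ a) => by
        have h1 := h.1
        exact le_trans (by linarith) (le_max_right 0 (a - z e))) inter_subset_left
    have hφ := h0 (D ∩ {e | a - t ≤ y e})
    have h1 : 2 * t * f (D ∩ {e | z e < t ∧ t ≤ a}) ≤
        1 / κ * sqLayer f D y (a - t) := by
      rw [sqLayer_of_pos y hs0, ← mul_assoc]
      refine mul_le_mul ?_ hc hc0 (by positivity)
      rw [one_div, ← div_eq_inv_mul, le_div_iff₀ hκ]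
      nlinarith
    linarith

/-- Pointwise bound at the threshold `t` for edges lying above the vertex value `a`. -/
lemma two_mul_above_le (h0 : ∀ A, 0 ≤ f A) (he : f ∅ = 0)
    (hm : ∀ A B, A ⊆ B → B ⊆ D → f A ≤ f B) {a κ t : ℝ} (ha : 0 ≤ a) (hκ : 0 < κ)
    (z : E → ℝ) :
    2 * t * f (D ∩ {e | t ≤ z e ∧ a < t}) ≤
      (Icc a (a + κ * a)).indicator (fun _ => 2 * a * f D) t
        + (1 / κ + 1) * sqLayer f D (fun e => max 0 (z e - a)) (t - a) := by
  set y : E → ℝ := fun e => max 0 (z e - a) with hy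
  have hD := h0 D
  have hG := sqLayer_nonneg (D := D) h0 y (t - a)
  have hI : 0 ≤ (Icc a (a + κ * a)).indicator (fun _ => 2 * a * f D) t :=
    indicator_nonneg (fun _ _ => by positivity) t
  have hR : 0 ≤ 1 / κ * sqLayer f D y (t - a) := by positivity
  have hc0 := h0 (D ∩ {e | t ≤ z e ∧ a < t})
  have hcD := hm (D ∩ {e | t ≤ z e ∧ a < t}) D inter_subset_left Subset.rfl
  rcases le_or_gt t a with h | h
  · have : D ∩ {e | t ≤ z e ∧ a < t} = ∅ := by
      ext e; simp [h.not_gt]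
    rw [this, he]
    linarith
  have hs0 : 0 < t - a := sub_pos.2 h
  have hc := hm (D ∩ {e | t ≤ z e ∧ a < t}) (D ∩ {e | t - a ≤ y e})
    (inter_subset_inter_right _ fun e (h : t ≤ z e ∧ a < t) => by
      have h1 := h.1
      exact le_trans (by linarith) (le_max_right 0 (z e - a))) inter_subset_left
  have hsG : 2 * (t - a) * f (D ∩ {e | t ≤ z e ∧ a < t}) ≤ sqLayer f D y (t - a) := by
    rw [sqLayer_of_pos y hs0]
    gcongr
  by_cases hs : t - a ≤ κ * a
  · rw [indicator_of_mem (mem_Icc.2 ⟨h.le, by linarith⟩)]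
    have : 2 * a * f (D ∩ {e | t ≤ z e ∧ a < t}) ≤ 2 * a * f D := by gcongr
    linarith
  · push Not at hs
    have h1 : 2 * a * f (D ∩ {e | t ≤ z e ∧ a < t}) ≤ 1 / κ * sqLayer f D y (t - a) := by
      rw [sqLayer_of_pos y hs0, ← mul_assoc]
      refine mul_le_mul ?_ hc hc0 (by positivity)
      rw [one_div, ← div_eq_inv_mul, le_div_iff₀ hκ]
      nlinarith
    linarith

lemma lovOn_mono_sq [Finite E] (h0 : ∀ A, 0 ≤ f A) (he : f ∅ = 0)
    (hm : ∀ A B, A ⊆ B → B ⊆ D → f A ≤ f B) {y y' : E → ℝ} (hy : ∀ e, 0 ≤ y e)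
    (hyy' : ∀ e, y e ≤ y' e) :
    lovOn f D (fun e => y e ^ 2) ≤ lovOn f D (fun e => y' e ^ 2) := by
  rw [← integral_sqLayer y hy, ← integral_sqLayer y' fun e => (hy e).trans (hyy' e)]
  refine integral_mono (integrable_sqLayer h0 he hm y) (integrable_sqLayer h0 he hm y') fun s => ?_
  by_cases hs : 0 < s
  · rw [sqLayer_of_pos y hs, sqLayer_of_pos y' hs]
    have := hm (D ∩ {e | s ≤ y e}) (D ∩ {e | s ≤ y' e})
      (inter_subset_inter_right _ fun e (h : s ≤ y e) => h.trans (hyy' e)) inter_subset_left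
    gcongr
  · simp [sqLayer, hs]

lemma integrable_indicator_Icc (b c r : ℝ) :
    Integrable ((Icc b c).indicator fun _ => r) :=
  (integrable_indicator_iff measurableSet_Icc).2 (integrableOn_const (by simp))

lemma integral_indicator_Icc {b c : ℝ} (h : b ≤ c) (r : ℝ) :
    ∫ t, (Icc b c).indicator (fun _ => r) t = (c - b) * r := by
  rw [integral_indicator measurableSet_Icc, setIntegral_const, smul_eq_mul, Measure.real,
    Real.volume_Icc, ENNReal.toReal_ofReal (sub_nonneg.2 h)]

lemma integrable_indicator_Ioc_two_mul (a : ℝ) :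
    Integrable ((Ioc (0 : ℝ) a).indicator fun t => 2 * t) :=
  (integrable_indicator_iff measurableSet_Ioc).2
    ((continuous_const.mul continuous_id).integrableOn_Ioc)

lemma integral_indicator_Ioc_two_mul {a : ℝ} (ha : 0 ≤ a) :
    ∫ t, (Ioc (0 : ℝ) a).indicator (fun t => 2 * t) t = a ^ 2 := by
  rw [integral_indicator measurableSet_Ioc, ← intervalIntegral.integral_of_le ha,
    intervalIntegral.integral_const_mul, integral_id]
  ring

end Layer

namespace PolyNet

open Set

variable {V E : Type*} [Fintype V] [Fintype E] (N : PolyNet V E)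

/-- The network with all edges reversed. -/
def reverse : PolyNet V E where
  tail := N.head
  head := N.tail
  w := N.w
  w_nonneg := N.w_nonneg
  ρp := N.ρm
  ρm := N.ρp
  ρp_nonneg := N.ρm_nonneg
  ρm_nonneg := N.ρp_nonneg
  ρp_empty := N.ρm_empty
  ρm_empty := N.ρp_empty
  ρp_mono := N.ρm_mono
  ρm_mono := N.ρp_mono
  ρp_submod := N.ρm_submod
  ρm_submod := N.ρp_submod

lemma reverse_deg (v : V) : N.reverse.deg v = N.deg v := add_comm _ _

lemma reverse_vol (S : Set V) : N.reverse.vol S = N.vol S := by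
  simp only [vol, funext N.reverse_deg]

lemma reverse_cut (F : Set E) : N.reverse.cut F = N.cut F := by
  have hc : ∀ g, N.reverse.cutCost F g = N.cutCost F g := fun g =>
    Finset.sum_congr rfl fun v _ => add_comm _ _
  have hv : ∀ g, N.reverse.valid F g ↔ N.valid F g := fun g =>
    forall₂_congr fun e _ => or_comm
  simp only [cut, hc, hv]

lemma reverse_dplus (S : Set V) : N.reverse.dplus S = N.dminus S :=
  Set.ext fun _ => and_comm

/-- The numerator of the Rayleigh quotient `R⁺`. -/
noncomputable def energy (x : V ⊕ E → ℝ) : ℝ :=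
  ∑ v, (lovOn (N.ρp v) (N.outE v) (fun e => (max 0 (x (Sum.inl v) - x (Sum.inr e)))^2)
    + lovOn (N.ρm v) (N.inE v) (fun e => (max 0 (x (Sum.inr e) - x (Sum.inl v)))^2))

lemma lovOn_ρp_mono (v : V) {y y' : E → ℝ} (hy : ∀ e, 0 ≤ y e) (hyy' : ∀ e, y e ≤ y' e) :
    lovOn (N.ρp v) (N.outE v) (fun e => y e ^ 2) ≤ lovOn (N.ρp v) (N.outE v) (fun e => y' e ^ 2) :=
  lovOn_mono_sq (N.ρp_nonneg v) (N.ρp_empty v) (N.ρp_mono v) hy hyy'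

lemma lovOn_ρm_mono (v : V) {y y' : E → ℝ} (hy : ∀ e, 0 ≤ y e) (hyy' : ∀ e, y e ≤ y' e) :
    lovOn (N.ρm v) (N.inE v) (fun e => y e ^ 2) ≤ lovOn (N.ρm v) (N.inE v) (fun e => y' e ^ 2) :=
  lovOn_mono_sq (N.ρm_nonneg v) (N.ρm_empty v) (N.ρm_mono v) hy hyy'

lemma energy_posPart_le (x : V ⊕ E → ℝ) (c : ℝ) :
    N.energy (fun i => max 0 (x i - c)) ≤ N.energy x := by
  have key : ∀ p q : ℝ, max 0 (max 0 (p - c) - max 0 (q - c)) ≤ max 0 (p - q) := by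
    intro p q
    grind
  exact Finset.sum_le_sum fun v _ => add_le_add
    (N.lovOn_ρp_mono v (fun _ => le_max_left _ _) fun _ => key _ _)
    (N.lovOn_ρm_mono v (fun _ => le_max_left _ _) fun _ => key _ _)

lemma reverse_energy_negPart_le (x : V ⊕ E → ℝ) (c : ℝ) :
    N.reverse.energy (fun i => max 0 (c - x i)) ≤ N.energy x := by
  have key : ∀ p q : ℝ, max 0 (max 0 (c - p) - max 0 (c - q)) ≤ max 0 (q - p) := by
    intro p q
    grind
  unfold energy
  refine Finset.sum_le_sum fun v _ => ?_
  rw [add_comm (lovOn (N.ρp v) _ _)]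
  exact add_le_add
    (N.lovOn_ρm_mono v (fun _ => le_max_left _ _) fun _ => key _ _)
    (N.lovOn_ρp_mono v (fun _ => le_max_left _ _) fun _ => key _ _)

lemma deg_nonneg (v : V) : 0 ≤ N.deg v :=
  add_nonneg (N.ρp_nonneg v _) (N.ρm_nonneg v _)

lemma vol_nonneg (S : Set V) : 0 ≤ N.vol S :=
  Finset.sum_nonneg fun v _ => indicator_nonneg (fun v _ => N.deg_nonneg v) v

lemma vol_mono {S T : Set V} (h : S ⊆ T) : N.vol S ≤ N.vol T :=
  Finset.sum_le_sum fun v _ =>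
    indicator_le_indicator_of_subset h (fun v => N.deg_nonneg v) v

lemma vol_add_vol_compl (S : Set V) : N.vol S + N.vol Sᶜ = N.vol univ := by
  simp only [vol, ← Finset.sum_add_distrib, indicator_univ, indicator_self_add_compl_apply]

lemma cutCost_nonneg (F : Set E) (g : E → V) : 0 ≤ N.cutCost F g :=
  Finset.sum_nonneg fun v _ => add_nonneg (N.ρp_nonneg v _) (N.ρm_nonneg v _)

lemma cut_nonneg (F : Set E) : 0 ≤ N.cut F :=
  Real.sInf_nonneg (by rintro _ ⟨g, -, rfl⟩; exact N.cutCost_nonneg F g)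

lemma cut_le_cutCost {F : Set E} {g : E → V} (hg : N.valid F g) : N.cut F ≤ N.cutCost F g :=
  csInf_le ⟨0, by rintro _ ⟨g, -, rfl⟩; exact N.cutCost_nonneg F g⟩ ⟨g, hg, rfl⟩

lemma cut_dplus_le_vol (S : Set V) : N.cut (N.dplus S) ≤ N.vol S := by
  refine (N.cut_le_cutCost (g := N.tail) fun e _ => Or.inl rfl).trans
    (Finset.sum_le_sum fun v _ => ?_)
  have hm : N.inE v ∩ N.dplus S ∩ {e | N.tail e = v} = ∅ := by
    ext e
    simp only [inE, dplus, mem_inter_iff, mem_ofPred_eq, mem_empty_iff_false, iff_false]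
    rintro ⟨⟨h1, h2, h3⟩, h4⟩
    exact h3 (h1 ▸ h4 ▸ h2)
  rw [hm, N.ρm_empty, add_zero]
  by_cases hv : v ∈ S
  · rw [indicator_of_mem hv]
    exact (N.ρp_mono v _ _ (inter_subset_left.trans inter_subset_left) Subset.rfl).trans
      (le_add_of_nonneg_right (N.ρm_nonneg v _))
  · have hp : N.outE v ∩ N.dplus S ∩ {e | N.tail e = v} = ∅ := by
      ext e
      simp only [outE, dplus, mem_inter_iff, mem_ofPred_eq, mem_empty_iff_false, iff_false]
      rintro ⟨⟨h1, h2, h3⟩, h4⟩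
      exact hv (h4 ▸ h2)
    rw [hp, N.ρp_empty, indicator_of_notMem hv]

/-- Cutting the superlevel set at threshold `t`: assign a cut edge to its tail when its own
value lies below `t`, and to its head otherwise. -/
lemma cut_superlevel_le (z : V ⊕ E → ℝ) (t : ℝ) :
    N.cut (N.dplus {v | t ≤ z (Sum.inl v)}) ≤
      ∑ v, (N.ρp v (N.outE v ∩ {e | z (Sum.inr e) < t ∧ t ≤ z (Sum.inl v)})
        + N.ρm v (N.inE v ∩ {e | t ≤ z (Sum.inr e) ∧ z (Sum.inl v) < t})) := by
  classical
  let g : E → V := fun e => if z (Sum.inr e) < t then N.tail e else N.head e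
  have hg : N.valid (N.dplus {v | t ≤ z (Sum.inl v)}) g := fun e _ => by
    by_cases h : z (Sum.inr e) < t <;> simp [g, h]
  refine (N.cut_le_cutCost hg).trans (Finset.sum_le_sum fun v _ => add_le_add ?_ ?_)
  · refine N.ρp_mono v _ _ ?_ inter_subset_left
    rintro e ⟨⟨h1, h2, h3⟩, h4⟩
    simp only [outE, mem_ofPred_eq, g] at h1 h2 h3 h4
    subst h1
    by_cases h : z (Sum.inr e) < t
    · exact ⟨rfl, h, h2⟩
    · rw [if_neg h] at h4
      exact absurd (h4 ▸ h2) h3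
  · refine N.ρm_mono v _ _ ?_ inter_subset_left
    rintro e ⟨⟨h1, h2, h3⟩, h4⟩
    simp only [inE, mem_ofPred_eq, g] at h1 h2 h3 h4
    subst h1
    by_cases h : z (Sum.inr e) < t
    · rw [if_pos h] at h4
      exact absurd (h4 ▸ h2) h3
    · exact ⟨rfl, not_lt.1 h, not_le.1 h3⟩

/-- Integrated threshold rounding. -/
lemma expansion_mul_le_energy (z : V ⊕ E → ℝ) (hz : ∀ v, 0 ≤ z (Sum.inl v)) {Φ κ : ℝ}
    (hκ : 0 < κ)
    (hΦ : ∀ t, 0 < t → Φ * N.vol {v | t ≤ z (Sum.inl v)} ≤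
      N.cut (N.dplus {v | t ≤ z (Sum.inl v)})) :
    Φ * ∑ v, N.deg v * z (Sum.inl v) ^ 2 ≤
      2 * κ * ∑ v, N.deg v * z (Sum.inl v) ^ 2 + (1 / κ + 1) * N.energy z := by
  let Gp : V → ℝ → ℝ := fun v =>
    sqLayer (N.ρp v) (N.outE v) fun e => max 0 (z (Sum.inl v) - z (Sum.inr e))
  let Gm : V → ℝ → ℝ := fun v =>
    sqLayer (N.ρm v) (N.inE v) fun e => max 0 (z (Sum.inr e) - z (Sum.inl v))
  let Fp : V → ℝ → ℝ := fun v t =>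
    (Icc (z (Sum.inl v) - κ * z (Sum.inl v)) (z (Sum.inl v))).indicator
      (fun _ => 2 * z (Sum.inl v) * N.ρp v (N.outE v)) t + 1 / κ * Gp v (z (Sum.inl v) - t)
  let Fm : V → ℝ → ℝ := fun v t =>
    (Icc (z (Sum.inl v)) (z (Sum.inl v) + κ * z (Sum.inl v))).indicator
      (fun _ => 2 * z (Sum.inl v) * N.ρm v (N.inE v)) t + (1 / κ + 1) * Gm v (t - z (Sum.inl v))
  have hGp : ∀ v, Integrable (Gp v) := fun v =>
    integrable_sqLayer (N.ρp_nonneg v) (N.ρp_empty v) (N.ρp_mono v) _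
  have hGm : ∀ v, Integrable (Gm v) := fun v =>
    integrable_sqLayer (N.ρm_nonneg v) (N.ρm_empty v) (N.ρm_mono v) _
  have hGp' : ∀ v, Integrable fun t => 1 / κ * Gp v (z (Sum.inl v) - t) := fun v =>
    ((hGp v).comp_sub_left _).const_mul _
  have hGm' : ∀ v, Integrable fun t => (1 / κ + 1) * Gm v (t - z (Sum.inl v)) := fun v =>
    ((hGm v).comp_sub_right _).const_mul _
  have hFp : ∀ v, Integrable (Fp v) := fun v => (integrable_indicator_Icc _ _ _).add (hGp' v)
  have hFm : ∀ v, Integrable (Fm v) := fun v => (integrable_indicator_Icc _ _ _).add (hGm' v)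
  have hL : ∀ v, Integrable fun t =>
      N.deg v * (Ioc 0 (z (Sum.inl v))).indicator (fun t => 2 * t) t := fun v =>
    (integrable_indicator_Ioc_two_mul _).const_mul _
  have hIL : ∫ t, Φ * ∑ v, N.deg v * (Ioc 0 (z (Sum.inl v))).indicator (fun t => 2 * t) t
      = Φ * ∑ v, N.deg v * z (Sum.inl v) ^ 2 := by
    rw [integral_const_mul, integral_finsetSum _ fun v _ => hL v]
    congr 1
    refine Finset.sum_congr rfl fun v _ => ?_
    rw [integral_const_mul, integral_indicator_Ioc_two_mul (hz v)]
  have hIp : ∀ v, ∫ t, Fp v t = 2 * κ * (N.ρp v (N.outE v) * z (Sum.inl v) ^ 2)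
      + 1 / κ * lovOn (N.ρp v) (N.outE v)
        (fun e => (max 0 (z (Sum.inl v) - z (Sum.inr e))) ^ 2) := fun v => by
    have := mul_nonneg hκ.le (hz v)
    rw [integral_add (integrable_indicator_Icc _ _ _) (hGp' v), integral_const_mul,
      integral_sub_left_eq_self (Gp v) volume, integral_indicator_Icc (by linarith),
      integral_sqLayer _ fun e => le_max_left _ _]
    ring
  have hIm : ∀ v, ∫ t, Fm v t = 2 * κ * (N.ρm v (N.inE v) * z (Sum.inl v) ^ 2)
      + (1 / κ + 1) * lovOn (N.ρm v) (N.inE v)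
        (fun e => (max 0 (z (Sum.inr e) - z (Sum.inl v))) ^ 2) := fun v => by
    have := mul_nonneg hκ.le (hz v)
    rw [integral_add (integrable_indicator_Icc _ _ _) (hGm' v), integral_const_mul,
      integral_sub_right_eq_self (Gm v), integral_indicator_Icc (by linarith),
      integral_sqLayer _ fun e => le_max_left _ _]
    ring
  have hpt : ∀ t, Φ * ∑ v, N.deg v * (Ioc 0 (z (Sum.inl v))).indicator (fun t => 2 * t) t
      ≤ ∑ v, (Fp v t + Fm v t) := by
    intro t
    rcases le_or_gt t 0 with ht | ht
    · have h0 : ∀ v, (Ioc 0 (z (Sum.inl v))).indicator (fun t => 2 * t) t = 0 := fun v =>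
        indicator_of_notMem (fun h => absurd h.1 ht.not_gt) _
      simp only [h0, mul_zero, Finset.sum_const_zero]
      refine Finset.sum_nonneg fun v _ => ?_
      have h1 : 0 ≤ Gp v (z (Sum.inl v) - t) := sqLayer_nonneg (N.ρp_nonneg v) _ _
      have h2 : 0 ≤ Gm v (t - z (Sum.inl v)) := sqLayer_nonneg (N.ρm_nonneg v) _ _
      have h3 := mul_nonneg (mul_nonneg zero_le_two (hz v)) (N.ρp_nonneg v (N.outE v))
      have h4 := mul_nonneg (mul_nonneg zero_le_two (hz v)) (N.ρm_nonneg v (N.inE v))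
      exact add_nonneg
        (add_nonneg (indicator_nonneg (fun _ _ => h3) t) (by positivity))
        (add_nonneg (indicator_nonneg (fun _ _ => h4) t) (by positivity))
    · have hvol : ∑ v, N.deg v * (Ioc 0 (z (Sum.inl v))).indicator (fun t => 2 * t) t
          = 2 * t * N.vol {v | t ≤ z (Sum.inl v)} := by
        rw [vol, Finset.mul_sum]
        refine Finset.sum_congr rfl fun v _ => ?_
        by_cases h : t ≤ z (Sum.inl v)
        · rw [indicator_of_mem (mem_Ioc.2 ⟨ht, h⟩), indicator_of_mem (by exact h)]
          ring
        · rw [indicator_of_notMem fun h' => h h'.2, indicator_of_notMem (by exact h)]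
          ring
      rw [hvol]
      calc Φ * (2 * t * N.vol {v | t ≤ z (Sum.inl v)})
          = 2 * t * (Φ * N.vol {v | t ≤ z (Sum.inl v)}) := by ring
        _ ≤ 2 * t * _ := mul_le_mul_of_nonneg_left
            ((hΦ t ht).trans (N.cut_superlevel_le z t)) (by positivity)
        _ ≤ _ := by
          rw [Finset.mul_sum]
          refine Finset.sum_le_sum fun v _ => ?_
          rw [mul_add]
          exact add_le_add
            (two_mul_below_le (N.ρp_nonneg v) (N.ρp_empty v) (N.ρp_mono v) (hz v) hκ _)
            (two_mul_above_le (N.ρm_nonneg v) (N.ρm_empty v) (N.ρm_mono v) (hz v) hκ _)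
  have hint := integral_mono ((integrable_finsetSum _ fun v _ => hL v).const_mul Φ)
    (integrable_finsetSum _ fun v _ => (hFp v).add (hFm v)) hpt
  rw [hIL] at hint
  refine hint.trans ?_
  have hR : ∫ t, ∑ v, (Fp v + Fm v) t = ∑ v, ((∫ t, Fp v t) + ∫ t, Fm v t) := by
    rw [integral_finsetSum _ fun v _ => (hFp v).add (hFm v)]
    exact Finset.sum_congr rfl fun v _ => integral_add (hFp v) (hFm v)
  refine hR.le.trans ?_
  rw [energy, Finset.mul_sum, Finset.mul_sum, ← Finset.sum_add_distrib]
  refine Finset.sum_le_sum fun v _ => ?_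
  rw [hIp, hIm, deg]
  have : 0 ≤ lovOn (N.ρp v) (N.outE v)
      (fun e => (max 0 (z (Sum.inl v) - z (Sum.inr e))) ^ 2) :=
    integral_nonneg fun θ => N.ρp_nonneg v _
  linarith

/-- A weighted median of the vertex values. -/
lemma exists_median [Nonempty V] (x : V → ℝ) :
    ∃ c, N.vol {v | c < x v} ≤ N.vol univ / 2 ∧ N.vol {v | x v < c} ≤ N.vol univ / 2 := by
  have hne : {u | N.vol univ / 2 ≤ N.vol {v | x v ≤ x u}}.Nonempty := by
    obtain ⟨u, hu⟩ := Finite.exists_max x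
    refine ⟨u, ?_⟩
    have hu' : {v | x v ≤ x u} = univ := eq_univ_of_forall hu
    rw [mem_ofPred_eq, hu']
    exact half_le_self (N.vol_nonneg univ)
  obtain ⟨u, hu, hmin⟩ := Set.exists_min_image _ x (Set.toFinite _) hne
  refine ⟨x u, ?_, ?_⟩
  · have h := N.vol_add_vol_compl {v | x v ≤ x u}
    have hc : {v | x v ≤ x u}ᶜ = {v | x u < x v} := by ext; simp
    rw [hc] at h
    have hu : N.vol univ / 2 ≤ N.vol {v | x v ≤ x u} := hu
    linarith
  · rcases {v | x v < x u}.eq_empty_or_nonempty with h | h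
    · rw [h]
      have h0 : N.vol ∅ = 0 := by simp [vol]
      exact h0.trans_le (div_nonneg (N.vol_nonneg univ) zero_le_two)
    · obtain ⟨m, hm, hmax⟩ := Set.exists_max_image _ x (Set.toFinite _) h
      refine (N.vol_mono fun v hv => hmax v hv).trans ?_
      by_contra! hlt
      exact absurd (hmin m hlt.le) (not_le.2 hm)

/-- Any lower bound `Φ` on the expansion of small sets is controlled by `R⁺`. -/
lemma expansion_le_Rp {Φ κ : ℝ} (hκ : 0 < κ)
    (hΦ : ∀ S, 0 < N.vol S → N.vol S ≤ N.vol univ / 2 → Φ * N.vol S ≤ N.cutval S)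
    {x : V ⊕ E → ℝ} (hx0 : ∑ v, N.deg v * x (Sum.inl v) = 0)
    (hx1 : 0 < ∑ v, N.deg v * x (Sum.inl v) ^ 2) :
    Φ ≤ 2 * κ + (1 / κ + 1) * (2 * N.Rp x) := by
  have : Nonempty V := by
    by_contra h
    rw [not_nonempty_iff] at h
    simp at hx1
  obtain ⟨c, hc1, hc2⟩ := N.exists_median fun v => x (Sum.inl v)
  have hRp : N.energy x = N.Rp x * ∑ v, N.deg v * x (Sum.inl v) ^ 2 :=
    (div_mul_cancel₀ _ hx1.ne').symm
  have hsum : ∑ v, N.deg v * x (Sum.inl v) ^ 2 ≤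
      ∑ v, N.deg v * (max 0 (x (Sum.inl v) - c)) ^ 2 +
      ∑ v, N.deg v * (max 0 (c - x (Sum.inl v))) ^ 2 := by
    have h1 : ∀ v, N.deg v * (max 0 (x (Sum.inl v) - c)) ^ 2 +
        N.deg v * (max 0 (c - x (Sum.inl v))) ^ 2 =
        N.deg v * x (Sum.inl v) ^ 2 - 2 * c * (N.deg v * x (Sum.inl v)) + c ^ 2 * N.deg v := by
      intro v
      rcases le_total (x (Sum.inl v)) c with h | h
      · rw [max_eq_left (sub_nonpos.2 h), max_eq_right (sub_nonneg.2 h)]; ring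
      · rw [max_eq_right (sub_nonneg.2 h), max_eq_left (sub_nonpos.2 h)]; ring
    rw [← Finset.sum_add_distrib, Finset.sum_congr rfl fun v _ => h1 v, Finset.sum_add_distrib,
      Finset.sum_sub_distrib, ← Finset.mul_sum, ← Finset.mul_sum, hx0]
    have := mul_nonneg (sq_nonneg c) (Finset.sum_nonneg fun v (_ : v ∈ Finset.univ) => N.deg_nonneg v)
    linarith
  have hΦ' : ∀ S, N.vol S ≤ N.vol univ / 2 →
      Φ * N.vol S ≤ N.cut (N.dplus S) ∧ Φ * N.vol S ≤ N.cut (N.dminus S) := by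
    intro S hS
    rcases (N.vol_nonneg S).eq_or_lt with h | h
    · rw [← h, mul_zero]
      exact ⟨N.cut_nonneg _, N.cut_nonneg _⟩
    · exact le_min_iff.1 (hΦ S h hS)
  have hp := N.expansion_mul_le_energy (fun i => max 0 (x i - c)) (fun v => le_max_left _ _)
    (Φ := Φ) hκ fun t ht => (hΦ' _ ((N.vol_mono fun v hv => ?_).trans hc1)).1
  · have hm := N.reverse.expansion_mul_le_energy (fun i => max 0 (c - x i))
      (fun v => le_max_left _ _) (Φ := Φ) hκ fun t ht => by
        rw [reverse_vol, reverse_cut, reverse_dplus]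
        refine (hΦ' _ ((N.vol_mono fun v hv => ?_).trans hc2)).2
        rcases le_max_iff.1 (show t ≤ max 0 (c - x (Sum.inl v)) from hv) with h | h
        · exact absurd h ht.not_ge
        · exact sub_pos.1 (ht.trans_le h)
    simp only [reverse_deg] at hm
    have hEp := (N.energy_posPart_le x c).trans_eq hRp
    have hEm := (N.reverse_energy_negPart_le x c).trans_eq hRp
    set P := ∑ v, N.deg v * (max 0 (x (Sum.inl v) - c)) ^ 2
    set M := ∑ v, N.deg v * (max 0 (c - x (Sum.inl v))) ^ 2
    set X := ∑ v, N.deg v * x (Sum.inl v) ^ 2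
    have hk : 0 ≤ 1 / κ + 1 := by positivity
    have hp' := hp.trans (add_le_add_right (mul_le_mul_of_nonneg_left hEp hk) _)
    have hm' := hm.trans (add_le_add_right (mul_le_mul_of_nonneg_left hEm hk) _)
    by_contra! hlt
    have hd : 0 ≤ N.Rp x := by
      refine div_nonneg (Finset.sum_nonneg fun v _ => add_nonneg ?_ ?_) hx1.le
      · exact integral_nonneg fun θ => N.ρp_nonneg v _
      · exact integral_nonneg fun θ => N.ρm_nonneg v _
    have hpos : 0 < Φ - 2 * κ := by
      have : 0 ≤ (1 / κ + 1) * (2 * N.Rp x) := by positivity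
      linarith
    have h1 : (Φ - 2 * κ) * X ≤ (Φ - 2 * κ) * (P + M) := mul_le_mul_of_nonneg_left hsum hpos.le
    have h2 := mul_lt_mul_of_pos_right hlt hx1
    nlinarith
  · rcases le_max_iff.1 (show t ≤ max 0 (x (Sum.inl v) - c) from hv) with h | h
    · exact absurd h ht.not_ge
    · exact sub_pos.1 (ht.trans_le h)

lemma Rm_eq_Rp_neg (x : V ⊕ E → ℝ) : N.Rm x = N.Rp (-x) := by
  simp only [Rm, Rp, Pi.neg_apply, neg_sq, neg_sub_neg]

lemma expansion_le_Ray {Φ κ : ℝ} (hκ : 0 < κ)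
    (hΦ : ∀ S, 0 < N.vol S → N.vol S ≤ N.vol univ / 2 → Φ * N.vol S ≤ N.cutval S)
    {x : V ⊕ E → ℝ} (hx0 : ∑ v, N.deg v * x (Sum.inl v) = 0)
    (hx1 : 0 < ∑ v, N.deg v * x (Sum.inl v) ^ 2) :
    Φ ≤ 2 * κ + (1 / κ + 1) * (2 * N.Ray x) := by
  rcases min_choice (N.Rp x) (N.Rm x) with h | h
  · rw [Ray, h]
    exact N.expansion_le_Rp hκ hΦ hx0 hx1
  · rw [Ray, h, Rm_eq_Rp_neg]
    refine N.expansion_le_Rp hκ hΦ ?_ ?_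
    · simpa using hx0
    · simpa using hx1

end PolyNet

/-- Hard direction of the Cheeger inequality for directed polymatroidal networks:
there is a set `S` with `0 < vol S ≤ vol V / 2` and `cutval S ≤ 32 √γ₂ · vol S`. -/
theorem cheeger_hard_direction {V E : Type*} [Fintype V] [Fintype E] (N : PolyNet V E)
    (hx : ∃ x : V ⊕ E → ℝ, (∑ v, N.deg v * x (Sum.inl v)) = 0 ∧
      0 < ∑ v, N.deg v * (x (Sum.inl v))^2) :
    ∃ S : Set V, 0 < N.vol S ∧ N.vol S ≤ N.vol Set.univ / 2 ∧
      N.cutval S ≤ 32 * Real.sqrt N.gap * N.vol S := by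
  obtain ⟨x₀, hx0, hx1⟩ := hx
  have hne : {S : Set V | 0 < N.vol S ∧ N.vol S ≤ N.vol Set.univ / 2}.Nonempty := by
    by_contra hemp
    rw [Set.not_nonempty_iff_eq_empty] at hemp
    have := N.expansion_le_Ray (Φ := 2 * 1 + (1 / 1 + 1) * (2 * N.Ray x₀) + 1) one_pos
      (fun S h1 h2 => (hemp.subset (show S ∈ {S | _} from ⟨h1, h2⟩)).elim) hx0 hx1
    linarith
  obtain ⟨S, ⟨hS0, hS1⟩, hmin⟩ :=
    Set.exists_min_image _ (fun S => N.cutval S / N.vol S) (Set.toFinite _) hne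
  refine ⟨S, hS0, hS1, ?_⟩
  rw [← div_le_iff₀ hS0]
  set Φ := N.cutval S / N.vol S with hΦdef
  have hΦ0 : 0 ≤ Φ := div_nonneg (le_min (N.cut_nonneg _) (N.cut_nonneg _)) hS0.le
  have hΦ1 : Φ ≤ 1 := (div_le_one hS0).2 ((min_le_left _ _).trans (N.cut_dplus_le_vol S))
  have hΦ : ∀ T, 0 < N.vol T → N.vol T ≤ N.vol Set.univ / 2 → Φ * N.vol T ≤ N.cutval T :=
    fun T h1 h2 => (le_div_iff₀ h1).1 (hmin T ⟨h1, h2⟩)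
  rcases hΦ0.eq_or_lt with h0 | hpos
  · rw [← h0]
    positivity
  have hgap : (Φ / 32) ^ 2 ≤ N.gap := by
    refine le_csInf ⟨_, x₀, hx0, hx1, rfl⟩ ?_
    rintro _ ⟨x, h1, h2, rfl⟩
    have h := N.expansion_le_Ray (κ := Φ / 4) (by positivity) hΦ h1 h2
    have h3 : (1 / (Φ / 4) + 1) * (2 * N.Ray x) = (4 + Φ) * (2 * N.Ray x) / Φ := by
      field_simp
    rw [h3] at h
    have h4 : Φ / 2 ≤ (4 + Φ) * (2 * N.Ray x) / Φ := by linarith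
    rw [le_div_iff₀ hpos] at h4
    have hR : 0 ≤ N.Ray x := by
      by_contra! hneg
      nlinarith
    nlinarith
  have := Real.le_sqrt_of_sq_le hgap
  linarith
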